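/- Let c > 0 and define γ(c) = (e^c + e^{−c})^{−1}, which lies in (0, 1/2). Let N ≥ 1 and let x₀, x₁, …, x_N be nonnegative real numbers satisfying x_k ≤ γ(c)·(x_{k−1} + x_{k+1}) for all 1 ≤ k ≤ N−1. Then for all 1 ≤ k ≤ N−1 one has the exponential decay estimate x_k ≤ x₀·e^{−ck} + x_N·e^{−c(N−k)}. -/

import Mathlib

/-- Discrete maximum principle: a sequence that is strictly subaveraging at interior points
and nonpositive at both ends is nonpositive. -/
theorem nonpos_of_le_mul_add_neighbors {N : ℕ} {g : ℝ} (hg : 0 ≤ g) (hg2 : 2 * g < 1)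
    {d : ℕ → ℝ} (h0 : d 0 ≤ 0) (hN : d N ≤ 0)
    (hrec : ∀ k, 1 ≤ k → k ≤ N - 1 → d k ≤ g * (d (k - 1) + d (k + 1))) :
    ∀ k ≤ N, d k ≤ 0 := by
  obtain ⟨m, hm, hmax⟩ := Finset.exists_max_image (Finset.range (N + 1)) d ⟨0, by simp⟩
  simp only [Finset.mem_range, Nat.lt_succ_iff] at hm hmax
  suffices hdm : d m ≤ 0 from fun k hk => (hmax k hk).trans hdm
  rcases Nat.eq_zero_or_pos m with rfl | hpos
  · exact h0
  rcases hm.eq_or_lt with rfl | hlt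
  · exact hN
  have h1 := hrec m hpos (by omega)
  have h2 : g * (d (m - 1) + d (m + 1)) ≤ g * (d m + d m) :=
    mul_le_mul_of_nonneg_left
      (add_le_add (hmax _ (by omega)) (hmax _ (by omega))) hg
  by_contra! hd
  nlinarith [mul_pos hd (sub_pos.2 hg2)]

/-- For `c ≠ 0` the constant `(e^c + e^{-c})⁻¹` is less than `1 / 2`. -/
theorem two_mul_inv_exp_add_exp_neg_lt_one {c : ℝ} (hc : c ≠ 0) :
    2 * (Real.exp c + Real.exp (-c))⁻¹ < 1 := by
  have h := Real.one_lt_cosh.2 hc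
  rw [Real.cosh_eq] at h
  rw [← div_eq_mul_inv, div_lt_one (by positivity)]
  linarith

/-- Combinations of `e^{-ct}` and `e^{-c(L-t)}` solve the three-term recursion. -/
theorem inv_exp_add_exp_neg_mul_add_neighbors (c a b L t : ℝ) :
    (Real.exp c + Real.exp (-c))⁻¹ *
      ((a * Real.exp (-(c * (t - 1))) + b * Real.exp (-(c * (L - (t - 1))))) +
        (a * Real.exp (-(c * (t + 1))) + b * Real.exp (-(c * (L - (t + 1)))))) =
      a * Real.exp (-(c * t)) + b * Real.exp (-(c * (L - t))) := by
  rw [inv_mul_eq_iff_eq_mul₀ (by positivity),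
    show -(c * (t - 1)) = -(c * t) + c by ring,
    show -(c * (t + 1)) = -(c * t) + -c by ring,
    show -(c * (L - (t - 1))) = -(c * (L - t)) + -c by ring,
    show -(c * (L - (t + 1))) = -(c * (L - t)) + c by ring]
  simp only [Real.exp_add]
  ring

/-- Exponential decay form of the three-interval lemma: with `γ(c) = (e^c + e^{-c})⁻¹`
and nonnegative `x₀, …, x_N` satisfying `x_k ≤ γ(c) (x_{k-1} + x_{k+1})` for
`1 ≤ k ≤ N - 1`, one has `x_k ≤ x₀ e^{-ck} + x_N e^{-c(N-k)}`. -/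
theorem three_interval_exponential_decay
    (c : ℝ) (hc : 0 < c)
    (N : ℕ) (hN : 1 ≤ N) (x : ℕ → ℝ) (hx : ∀ k, k ≤ N → 0 ≤ x k)
    (hrec : ∀ k : ℕ, 1 ≤ k → k ≤ N - 1 →
      x k ≤ (Real.exp c + Real.exp (-c))⁻¹ * (x (k - 1) + x (k + 1))) :
    ∀ k : ℕ, 1 ≤ k → k ≤ N - 1 →
      x k ≤ x 0 * Real.exp (-(c * (k : ℝ)))
            + x N * Real.exp (-(c * ((N - k : ℕ) : ℝ))) := by
  intro k _ hk
  have h0 := hx 0 (Nat.zero_le N)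
  have hN0 := hx N le_rfl
  have key := nonpos_of_le_mul_add_neighbors (N := N)
    (g := (Real.exp c + Real.exp (-c))⁻¹)
    (d := fun j => x j -
      (x 0 * Real.exp (-(c * (j : ℝ))) + x N * Real.exp (-(c * ((N : ℝ) - j)))))
    (by positivity) (two_mul_inv_exp_add_exp_neg_lt_one hc.ne')
    (by
      have : 0 ≤ x N * Real.exp (-(c * (N : ℝ))) := by positivity
      simpa using this)
    (by
      have : 0 ≤ x 0 * Real.exp (-(c * (N : ℝ))) := by positivity
      simpa using this)
    (by
      intro j hj hjN
      have h := hrec j hj hjN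
      have e := inv_exp_add_exp_neg_mul_add_neighbors c (x 0) (x N) N j
      simp only [Nat.cast_sub hj, Nat.cast_add, Nat.cast_one]
      linear_combination h + e)
    k (by omega)
  rw [Nat.cast_sub (by omega : k ≤ N)]
  exact sub_nonpos.1 key
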